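/- Let 𝒪 ⊂ ℝ^{m−k} × ℝ^n be open and let φ : 𝒪 → ℝᵏ be uniformly intrinsically differentiable at every point of 𝒪. Then φ is locally little-1/2-Hölder continuous with respect to the group quasi-norm: for every compact K ⊂ 𝒪, lim_{r→0⁺} sup { |φ(B) − φ(A)|_{ℝᵏ} / N(i(A)⁻¹·i(B))^{1/2} : A, B ∈ K, 0 < N(i(A)⁻¹·i(B)) < r } = 0. -/

import Mathlib

noncomputable section

open Set Filter Topology MeasureTheory

namespace Carnot

/-- Euclidean norm on `Fin d → ℝ`. -/
def enorm {d : ℕ} (x : Fin d → ℝ) : ℝ := Real.sqrt (∑ i, (x i) ^ 2)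

/-- The underlying set of the Carnot group `G = ℝ^m × ℝ^n` of class `𝓑`. -/
abbrev G (m n : ℕ) := (Fin m → ℝ) × (Fin n → ℝ)

/-- Points of the normal complement `W`, identified with `ℝ^(m-k) × ℝ^n`. -/
abbrev W (m n k : ℕ) := (Fin (m - k) → ℝ) × (Fin n → ℝ)

/-- The group law of the Carnot group of class `𝓑` associated with the
skew-symmetric matrices `b s`:
`(x,y)·(x',y') = (x + x', y + y' + ½⟨Bx,x'⟩)`. -/
def gmul {m n : ℕ} (b : Fin n → Matrix (Fin m) (Fin m) ℝ) (P Q : G m n) : G m n :=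
  (P.1 + Q.1, fun s => P.2 s + Q.2 s + (1 / 2) * ∑ i, ∑ j, b s i j * P.1 j * Q.1 i)

/-- The group inverse `(x,y)⁻¹ = (-x,-y)`. -/
def ginv {m n : ℕ} (P : G m n) : G m n := (-P.1, -P.2)

/-- The homogeneous quasi-norm `N(x,y) = |x| + |y|^(1/2)`. -/
def qnorm {m n : ℕ} (P : G m n) : ℝ := enorm P.1 + Real.sqrt (enorm P.2)

/-- Open ball for the quasi-norm: `U(P,r) = {Q : N(P⁻¹·Q) < r}`. -/
def ball (m n : ℕ) (b : Fin n → Matrix (Fin m) (Fin m) ℝ) (P : G m n) (r : ℝ) : Set (G m n) :=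
  {Q | qnorm (gmul b (ginv P) Q) < r}

/-- The embedding `i : ℝ^(m-k) × ℝ^n → G`, `i(a,α) = (0,…,0,a,α)`. -/
def embW (m n k : ℕ) (A : W m n k) : G m n :=
  (fun j => if h : (j : ℕ) < k then 0 else A.1 ⟨(j : ℕ) - k, by have := j.isLt; omega⟩, A.2)

/-- The embedding of `ℝ^k` as the horizontal subgroup `H`, `v ↦ (v,0,…,0)`. -/
def embH (m n k : ℕ) (v : Fin k → ℝ) : G m n :=
  (fun j => if h : (j : ℕ) < k then v ⟨(j : ℕ), h⟩ else 0, 0)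

/-- The graph map `Φ(A) = i(A)·φ̂(A)`. -/
def graphMap (m n k : ℕ) (b : Fin n → Matrix (Fin m) (Fin m) ℝ)
    (φ : W m n k → Fin k → ℝ) (A : W m n k) : G m n :=
  gmul b (embW m n k A) (embH m n k (φ A))

/-- `N(i(A)⁻¹·i(B))`. -/
def dW (m n k : ℕ) (b : Fin n → Matrix (Fin m) (Fin m) ℝ) (A B : W m n k) : ℝ :=
  qnorm (gmul b (ginv (embW m n k A)) (embW m n k B))

/-- The graph quasi-distance `σ_φ(A,B) = N(φ̂(A)⁻¹·i(A)⁻¹·i(B)·φ̂(A))`. -/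
def sigma (m n k : ℕ) (b : Fin n → Matrix (Fin m) (Fin m) ℝ)
    (φ : W m n k → Fin k → ℝ) (A B : W m n k) : ℝ :=
  qnorm (gmul b (gmul b (gmul b (ginv (embH m n k (φ A))) (ginv (embW m n k A)))
    (embW m n k B)) (embH m n k (φ A)))

/-- The matrix `M` satisfies the uniform intrinsic differentiability condition of `φ`
at `A₀ ∈ 𝒪`. -/
def UID (m n k : ℕ) (b : Fin n → Matrix (Fin m) (Fin m) ℝ) (O : Set (W m n k))
    (φ : W m n k → Fin k → ℝ) (A₀ : W m n k) (M : Matrix (Fin k) (Fin (m - k)) ℝ) : Prop :=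
  ∀ ε > 0, ∃ r > 0, ∀ A ∈ O, ∀ B ∈ O,
    dW m n k b A₀ A < r → dW m n k b A B < r → 0 < dW m n k b A B →
    enorm (fun j => φ B j - φ A j - ∑ i, M j i * (B.1 i - A.1 i)) ≤ ε * sigma m n k b φ A B

/-- `f : U → ℝ^k` is of class `C¹_G` with (continuous) horizontal Jacobian `gradf`. -/
def C1G (m n k : ℕ) (b : Fin n → Matrix (Fin m) (Fin m) ℝ) (U : Set (G m n))
    (f : G m n → Fin k → ℝ) (gradf : G m n → Matrix (Fin k) (Fin m) ℝ) : Prop :=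
  ContinuousOn f U ∧ ContinuousOn gradf U ∧
  ∀ P ∈ U, ∀ ε > 0, ∃ r > 0, ∀ Q ∈ U,
    qnorm (gmul b (ginv P) Q) < r →
    enorm (fun j => f Q j - f P j - ∑ i, gradf P j i * (Q.1 i - P.1 i)) ≤
      ε * qnorm (gmul b (ginv P) Q)

/-- The square block `M₁(Q) = (X_i f_j(Q))_{j,i=1,…,k}` of the horizontal Jacobian. -/
def M1 (m n k : ℕ) (hk : k ≤ m) (gradf : G m n → Matrix (Fin k) (Fin m) ℝ) (Q : G m n) :
    Matrix (Fin k) (Fin k) ℝ :=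
  Matrix.of fun j i => gradf Q j (Fin.castLE hk i)

/-- The block `M₂(Q) = (X_{k+i} f_j(Q))_{j=1,…,k; i=1,…,m-k}` of the horizontal Jacobian. -/
def M2 (m n k : ℕ) (gradf : G m n → Matrix (Fin k) (Fin m) ℝ) (Q : G m n) :
    Matrix (Fin k) (Fin (m - k)) ℝ :=
  Matrix.of fun j i => gradf Q j ⟨k + (i : ℕ), by have := i.isLt; omega⟩

lemma enorm_eq_norm {d : ℕ} (x : Fin d → ℝ) : enorm x = ‖WithLp.toLp 2 x‖ := by
  simp [enorm, EuclideanSpace.norm_eq]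

lemma enorm_nonneg {d : ℕ} (x : Fin d → ℝ) : 0 ≤ enorm x := Real.sqrt_nonneg _

lemma enorm_add_le {d : ℕ} (x y : Fin d → ℝ) : enorm (x + y) ≤ enorm x + enorm y := by
  simp only [enorm_eq_norm, WithLp.toLp_add]
  exact norm_add_le _ _

lemma enorm_zero {d : ℕ} : enorm (0 : Fin d → ℝ) = 0 := by simp [enorm]

lemma abs_apply_le_enorm {d : ℕ} (x : Fin d → ℝ) (i : Fin d) : |x i| ≤ enorm x := by
  rw [enorm_eq_norm]
  exact PiLp.norm_apply_le (WithLp.toLp 2 x) i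

lemma enorm_le_sum_abs {d : ℕ} (x : Fin d → ℝ) : enorm x ≤ ∑ i, |x i| := by
  refine Real.sqrt_le_iff.2 ⟨Finset.sum_nonneg fun i _ => abs_nonneg _, ?_⟩
  simpa using Finset.sum_sq_le_sq_sum_of_nonneg (s := Finset.univ) (f := fun i => |x i|)
    (fun i _ => abs_nonneg _)

lemma continuous_enorm {d : ℕ} : Continuous (enorm : (Fin d → ℝ) → ℝ) := by
  unfold enorm
  fun_prop

lemma eq_of_enorm_neg_add_eq_zero {d : ℕ} {x y : Fin d → ℝ} (h : enorm (-x + y) = 0) :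
    x = y := by
  funext i
  have := abs_apply_le_enorm (-x + y) i
  rw [h] at this
  have := abs_nonpos_iff.1 this
  simp only [Pi.add_apply, Pi.neg_apply] at this
  linarith

lemma sqrt_add_le_sqrt_add_sqrt {x y : ℝ} (hx : 0 ≤ x) (hy : 0 ≤ y) :
    Real.sqrt (x + y) ≤ Real.sqrt x + Real.sqrt y := by
  refine Real.sqrt_le_iff.2 ⟨by positivity, ?_⟩
  rw [add_sq, Real.sq_sqrt hx, Real.sq_sqrt hy]
  have : 0 ≤ 2 * Real.sqrt x * Real.sqrt y := by positivity
  linarith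

/-- The bilinear map `(v, w) ↦ ⟨Bv, w⟩`. -/
def bform {m n : ℕ} (b : Fin n → Matrix (Fin m) (Fin m) ℝ) (v w : Fin m → ℝ) : Fin n → ℝ :=
  fun s => ∑ i, ∑ j, b s i j * v j * w i

section bform

variable {m n : ℕ} (b : Fin n → Matrix (Fin m) (Fin m) ℝ)

lemma bform_add_left (v v' w : Fin m → ℝ) :
    bform b (v + v') w = bform b v w + bform b v' w := by
  funext s
  simp [bform, mul_add, add_mul, Finset.sum_add_distrib]

lemma bform_add_right (v w w' : Fin m → ℝ) :
    bform b v (w + w') = bform b v w + bform b v w' := by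
  funext s
  simp [bform, mul_add, Finset.sum_add_distrib]

lemma bform_neg_left (v w : Fin m → ℝ) : bform b (-v) w = -bform b v w := by
  funext s
  simp [bform]

lemma bform_neg_right (v w : Fin m → ℝ) : bform b v (-w) = -bform b v w := by
  funext s
  simp [bform]

lemma gmul_eq (P Q : G m n) :
    gmul b P Q = (P.1 + Q.1, P.2 + Q.2 + (1 / 2 : ℝ) • bform b P.1 Q.1) := rfl

variable {b}

lemma bform_self (hskew : ∀ s, (b s).transpose = -(b s)) (v : Fin m → ℝ) : bform b v v = 0 := by
  funext s
  have h : ∑ i, ∑ j, b s i j * v j * v i = -∑ i, ∑ j, b s i j * v j * v i := by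
    conv_lhs => rw [Finset.sum_comm]
    simp only [← Finset.sum_neg_distrib]
    refine Finset.sum_congr rfl fun i _ => Finset.sum_congr rfl fun j _ => ?_
    have := congrFun (congrFun (hskew s) i) j
    simp only [Matrix.transpose_apply, Matrix.neg_apply] at this
    rw [this]
    ring
  show ∑ i, ∑ j, b s i j * v j * v i = 0
  linarith

variable (b)

lemma exists_enorm_bform_le : ∃ C, 0 ≤ C ∧ ∀ (v w : Fin m → ℝ) (p q : ℝ),
    (∀ j, |v j| ≤ p) → (∀ i, |w i| ≤ q) → enorm (bform b v w) ≤ C * (p * q) := by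
  refine ⟨∑ s, ∑ i, ∑ j, |b s i j|, by positivity, fun v w p q hv hw => ?_⟩
  refine (enorm_le_sum_abs _).trans ?_
  simp only [Finset.sum_mul]
  refine Finset.sum_le_sum fun s _ => (Finset.abs_sum_le_sum_abs _ _).trans ?_
  refine Finset.sum_le_sum fun i _ => (Finset.abs_sum_le_sum_abs _ _).trans ?_
  refine Finset.sum_le_sum fun j _ => ?_
  rw [abs_mul, abs_mul, mul_assoc]
  have hp : 0 ≤ p := (abs_nonneg _).trans (hv j)
  gcongr
  · exact hv j
  · exact hw i

end bform

section distances

variable {m n k : ℕ} {b : Fin n → Matrix (Fin m) (Fin m) ℝ}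

lemma dW_eq (A B : W m n k) : dW m n k b A B =
    enorm (-(embW m n k A).1 + (embW m n k B).1) + Real.sqrt (enorm
      (-A.2 + B.2 + (1 / 2 : ℝ) • bform b (-(embW m n k A).1) (embW m n k B).1)) := rfl

lemma dW_nonneg (A B : W m n k) : 0 ≤ dW m n k b A B := by
  rw [dW_eq]
  exact add_nonneg (enorm_nonneg _) (Real.sqrt_nonneg _)

lemma enorm_horizontal_le_dW (A B : W m n k) :
    enorm (-(embW m n k A).1 + (embW m n k B).1) ≤ dW m n k b A B := by
  rw [dW_eq]
  exact le_add_of_nonneg_right (Real.sqrt_nonneg _)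

lemma embW_fst_apply (A : W m n k) (i : Fin (m - k)) (h : k + (i : ℕ) < m) :
    (embW m n k A).1 ⟨k + i, h⟩ = A.1 i := by
  simp [embW]

lemma abs_sub_le_dW (A B : W m n k) (i : Fin (m - k)) :
    |B.1 i - A.1 i| ≤ dW m n k b A B := by
  have hi : k + (i : ℕ) < m := by have := i.isLt; omega
  refine le_trans ?_ ((abs_apply_le_enorm _ ⟨k + i, hi⟩).trans (enorm_horizontal_le_dW A B))
  rw [Pi.add_apply, Pi.neg_apply, embW_fst_apply, embW_fst_apply, neg_add_eq_sub]

lemma dW_self (hskew : ∀ s, (b s).transpose = -(b s)) (A : W m n k) : dW m n k b A A = 0 := by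
  simp [dW_eq, bform_neg_left, bform_self hskew, enorm_zero]

lemma eq_of_dW_eq_zero (hskew : ∀ s, (b s).transpose = -(b s)) {A B : W m n k}
    (h : dW m n k b A B = 0) : A = B := by
  have h1 : A.1 = B.1 := by
    funext i
    have := abs_sub_le_dW (b := b) A B i
    rw [h] at this
    linarith [abs_nonpos_iff.1 this]
  have he : (embW m n k A).1 = (embW m n k B).1 := by
    simp only [embW, h1]
  rw [dW_eq, he, bform_neg_left, bform_self hskew] at h
  simp only [neg_add_cancel, enorm_zero, neg_zero, smul_zero, add_zero, zero_add] at h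
  exact Prod.ext h1 (eq_of_enorm_neg_add_eq_zero ((Real.sqrt_eq_zero (enorm_nonneg _)).1 h))

lemma continuous_embW_fst : Continuous fun A : W m n k => (embW m n k A).1 := by
  refine continuous_pi fun j => ?_
  by_cases h : (j : ℕ) < k
  · simp only [embW, h, dite_true]
    exact continuous_const
  · simp only [embW, h, dite_false]
    fun_prop

lemma continuous_dW (A : W m n k) : Continuous fun B => dW m n k b A B := by
  simp only [dW_eq]
  have h := continuous_embW_fst (m := m) (n := n) (k := k)
  have hb : Continuous fun B : W m n k =>
      bform b (-(embW m n k A).1) (embW m n k B).1 := by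
    refine (?_ : Continuous (bform b (-(embW m n k A).1))).comp h
    unfold bform
    fun_prop
  exact (continuous_enorm.comp (continuous_const.add h)).add
    (Real.continuous_sqrt.comp (continuous_enorm.comp
      ((continuous_const.add continuous_snd).add ((continuous_const_smul (1 / 2 : ℝ)).comp hb))))

lemma eventually_dW_lt (hskew : ∀ s, (b s).transpose = -(b s)) (A : W m n k) {r : ℝ}
    (hr : 0 < r) : ∀ᶠ B in 𝓝 A, dW m n k b A B < r :=
  (continuous_dW A).continuousAt.eventually_lt continuousAt_const (by rwa [dW_self hskew])

lemma abs_embH_fst_apply_le (v : Fin k → ℝ) (j : Fin m) :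
    |(embH m n k v).1 j| ≤ enorm v := by
  by_cases h : (j : ℕ) < k
  · simpa [embH, h] using abs_apply_le_enorm v ⟨j, h⟩
  · simpa [embH, h] using enorm_nonneg v

lemma sigma_eq (hskew : ∀ s, (b s).transpose = -(b s)) (φ : W m n k → Fin k → ℝ)
    (A B : W m n k) : sigma m n k b φ A B =
    enorm (-(embW m n k A).1 + (embW m n k B).1) + Real.sqrt (enorm
      ((-A.2 + B.2 + (1 / 2 : ℝ) • bform b (-(embW m n k A).1) (embW m n k B).1) +
        bform b (-(embW m n k A).1 + (embW m n k B).1) ((1 / 2 : ℝ) • (embH m n k (φ A)).1) +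
        bform b (-(1 / 2 : ℝ) • (embH m n k (φ A)).1)
          (-(embW m n k A).1 + (embW m n k B).1))) := by
  have hr (c : ℝ) (v w : Fin m → ℝ) : bform b v (c • w) = c • bform b v w := by
    funext s
    simp only [bform, Pi.smul_apply, smul_eq_mul, Finset.mul_sum]
    exact Finset.sum_congr rfl fun i _ => Finset.sum_congr rfl fun j _ => by ring
  have hl (c : ℝ) (v w : Fin m → ℝ) : bform b (c • v) w = c • bform b v w := by
    funext s
    simp only [bform, Pi.smul_apply, smul_eq_mul, Finset.mul_sum]
    exact Finset.sum_congr rfl fun i _ => Finset.sum_congr rfl fun j _ => by ring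
  have hA : (embW m n k A).2 = A.2 := rfl
  have hB : (embW m n k B).2 = B.2 := rfl
  have hH : (embH m n k (φ A)).2 = 0 := rfl
  unfold sigma qnorm
  simp only [gmul_eq, ginv, hA, hB, hH]
  congr 2
  · abel
  · congr 1
    simp only [hl, hr, bform_add_left, bform_add_right, bform_neg_left, bform_neg_right,
      bform_self hskew]
    module

lemma exists_sigma_le (hskew : ∀ s, (b s).transpose = -(b s)) : ∃ C, 0 ≤ C ∧
    ∀ (φ : W m n k → Fin k → ℝ) (A B : W m n k), sigma m n k b φ A B ≤
      dW m n k b A B + Real.sqrt (C * enorm (φ A)) * Real.sqrt (dW m n k b A B) := by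
  obtain ⟨C, hC, h⟩ := exists_enorm_bform_le b
  refine ⟨2 * C, by positivity, fun φ A B => ?_⟩
  have hφ (c : ℝ) (hc : |c| ≤ 1) (j : Fin m) :
      |(c • (embH m n k (φ A)).1) j| ≤ enorm (φ A) := by
    rw [Pi.smul_apply, smul_eq_mul, abs_mul]
    exact (mul_le_of_le_one_left (abs_nonneg _) hc).trans (abs_embH_fst_apply_le _ _)
  have hd (j : Fin m) :
      |(-(embW m n k A).1 + (embW m n k B).1) j| ≤ dW m n k b A B :=
    (abs_apply_le_enorm _ j).trans (enorm_horizontal_le_dW A B)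
  have h1 := h _ _ _ _ hd (hφ (1 / 2) (by norm_num [abs_of_pos]))
  have h2 := h _ _ _ _ (hφ (-(1 / 2)) (by norm_num [abs_of_pos])) hd
  have h0 := enorm_nonneg (φ A)
  have h3 := dW_nonneg (b := b) A B
  rw [sigma_eq hskew, ← Real.sqrt_mul (by positivity)]
  refine le_trans (add_le_add_right ((Real.sqrt_le_sqrt (?_ : _ ≤
    enorm (-A.2 + B.2 + (1 / 2 : ℝ) • bform b (-(embW m n k A).1) (embW m n k B).1) +
      2 * C * enorm (φ A) * dW m n k b A B)).trans
    (sqrt_add_le_sqrt_add_sqrt (enorm_nonneg _) (by positivity))) _) ?_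
  · have := enorm_add_le (-A.2 + B.2 + (1 / 2 : ℝ) • bform b (-(embW m n k A).1)
      (embW m n k B).1 + bform b (-(embW m n k A).1 + (embW m n k B).1)
        ((1 / 2 : ℝ) • (embH m n k (φ A)).1))
      (bform b (-(1 / 2 : ℝ) • (embH m n k (φ A)).1)
        (-(embW m n k A).1 + (embW m n k B).1))
    have := enorm_add_le (-A.2 + B.2 + (1 / 2 : ℝ) • bform b (-(embW m n k A).1)
      (embW m n k B).1) (bform b (-(embW m n k A).1 + (embW m n k B).1)
        ((1 / 2 : ℝ) • (embH m n k (φ A)).1))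
    linarith
  · rw [← add_assoc, ← dW_eq]

lemma exists_enorm_mulVec_le (M : Matrix (Fin k) (Fin (m - k)) ℝ) : ∃ L, 0 ≤ L ∧
    ∀ A B : W m n k, enorm (fun j => ∑ i, M j i * (B.1 i - A.1 i)) ≤ L * dW m n k b A B := by
  refine ⟨∑ j, ∑ i, |M j i|, by positivity, fun A B => (enorm_le_sum_abs _).trans ?_⟩
  simp only [Finset.sum_mul]
  refine Finset.sum_le_sum fun j _ => (Finset.abs_sum_le_sum_abs _ _).trans ?_
  refine Finset.sum_le_sum fun i _ => ?_
  rw [abs_mul]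
  gcongr
  exact abs_sub_le_dW A B i

/-- The increment estimate given by uniform intrinsic differentiability at `A₀`. -/
lemma UID.exists_enorm_sub_le (hskew : ∀ s, (b s).transpose = -(b s)) {O : Set (W m n k)}
    {φ : W m n k → Fin k → ℝ} {A₀ : W m n k} {M : Matrix (Fin k) (Fin (m - k)) ℝ}
    (h : UID m n k b O φ A₀ M) : ∃ L, 0 ≤ L ∧ ∃ C, 0 ≤ C ∧ ∀ ε > 0, ∃ r > 0,
      ∀ A ∈ O, ∀ B ∈ O, dW m n k b A₀ A < r → dW m n k b A B < r → 0 < dW m n k b A B →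
      enorm (fun j => φ B j - φ A j) ≤ L * dW m n k b A B +
        ε * (dW m n k b A B + Real.sqrt (C * enorm (φ A)) * Real.sqrt (dW m n k b A B)) := by
  obtain ⟨L, hL, hM⟩ := exists_enorm_mulVec_le (n := n) (b := b) M
  obtain ⟨C, hC, hσ⟩ := exists_sigma_le (k := k) hskew
  refine ⟨L, hL, C, hC, fun ε hε => ?_⟩
  obtain ⟨r, hr, hd⟩ := h ε hε
  refine ⟨r, hr, fun A hA B hB h₀ h₁ hpos => ?_⟩
  have hsum : (fun j => φ B j - φ A j) = (fun j => ∑ i, M j i * (B.1 i - A.1 i)) +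
      fun j => φ B j - φ A j - ∑ i, M j i * (B.1 i - A.1 i) := by
    funext j
    simp
  rw [hsum]
  exact (enorm_add_le _ _).trans (add_le_add (hM A B)
    ((hd A hA B hB h₀ h₁ hpos).trans (mul_le_mul_of_nonneg_left (hσ φ A B) hε.le)))

/-- A uniformly intrinsically differentiable map is locally bounded. -/
lemma UID.exists_eventually_enorm_le (hskew : ∀ s, (b s).transpose = -(b s))
    {O : Set (W m n k)} {φ : W m n k → Fin k → ℝ} {A₀ : W m n k} (hA₀ : A₀ ∈ O)
    {M : Matrix (Fin k) (Fin (m - k)) ℝ} (h : UID m n k b O φ A₀ M) :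
    ∃ R, 0 ≤ R ∧ ∀ᶠ A in 𝓝 A₀, A ∈ O → enorm (φ A) ≤ R := by
  obtain ⟨L, hL, C, hC, hinc⟩ := h.exists_enorm_sub_le hskew
  obtain ⟨r, hr, hd⟩ := hinc 1 one_pos
  have hR := enorm_nonneg (φ A₀)
  refine ⟨enorm (φ A₀) + (L * 1 + 1 * (1 + Real.sqrt (C * enorm (φ A₀)) * Real.sqrt 1)),
    by positivity, ?_⟩
  filter_upwards [eventually_dW_lt hskew A₀ hr, eventually_dW_lt hskew A₀ one_pos]
    with A hAr hA1 hAO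
  rcases (dW_nonneg (b := b) A₀ A).eq_or_lt with h0 | hpos
  · rw [← eq_of_dW_eq_zero hskew h0.symm]
    exact le_add_of_nonneg_right (by positivity)
  · have hA : φ A = φ A₀ + fun j => φ A j - φ A₀ j := by
      funext j
      simp
    rw [hA]
    refine (enorm_add_le _ _).trans (add_le_add le_rfl ?_)
    refine (hd A₀ hA₀ A hAO (by rwa [dW_self hskew]) hAr hpos).trans ?_
    gcongr

/-- A uniformly intrinsically differentiable map is little-1/2-Hölder near each point. -/
lemma UID.exists_eventually_enorm_sub_le (hskew : ∀ s, (b s).transpose = -(b s))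
    {O : Set (W m n k)} {φ : W m n k → Fin k → ℝ} {A₀ : W m n k} (hA₀ : A₀ ∈ O)
    {M : Matrix (Fin k) (Fin (m - k)) ℝ} (h : UID m n k b O φ A₀ M) {ε : ℝ} (hε : 0 < ε) :
    ∃ r > 0, ∀ᶠ A in 𝓝 A₀, A ∈ O → ∀ B ∈ O, 0 < dW m n k b A B → dW m n k b A B < r →
      enorm (fun j => φ B j - φ A j) ≤ ε * Real.sqrt (dW m n k b A B) := by
  obtain ⟨R, hR, hbdd⟩ := h.exists_eventually_enorm_le hskew hA₀
  obtain ⟨L, hL, C, hC, hinc⟩ := h.exists_enorm_sub_le hskew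
  set T := Real.sqrt (C * R) with hT
  have hT0 : 0 ≤ T := Real.sqrt_nonneg _
  obtain ⟨r, hr, hd⟩ := hinc (ε / (2 * (1 + T))) (by positivity)
  refine ⟨min r (min 1 ((ε / (2 * (L + 1))) ^ 2)), by positivity, ?_⟩
  filter_upwards [hbdd, eventually_dW_lt hskew A₀ hr] with A hAR hAr hAO B hBO hpos hlt
  obtain ⟨hlr, hl1, hlε⟩ : _ ∧ _ ∧ _ := by simpa only [lt_min_iff] using hlt
  refine (hd A hAO B hBO hAr hlr hpos).trans ?_
  set t := Real.sqrt (dW m n k b A B) with ht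
  have ht0 : 0 ≤ t := Real.sqrt_nonneg _
  have htd : dW m n k b A B = t * t := (Real.mul_self_sqrt hpos.le).symm
  have ht1 : t ≤ 1 := Real.sqrt_le_one.2 hl1.le
  have htε : t ≤ ε / (2 * (L + 1)) := Real.sqrt_le_iff.2 ⟨by positivity, hlε.le⟩
  have hTA : Real.sqrt (C * enorm (φ A)) ≤ T :=
    Real.sqrt_le_sqrt (mul_le_mul_of_nonneg_left (hAR hAO) hC)
  rw [htd]
  calc L * (t * t) + ε / (2 * (1 + T)) * (t * t + Real.sqrt (C * enorm (φ A)) * t)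
      ≤ (L + 1) * (t * (ε / (2 * (L + 1)))) + ε / (2 * (1 + T)) * (1 * t + T * t) := by
        gcongr
        linarith
    _ = ε * t := by
        field_simp
        ring

end distances

/-- A map `φ : 𝒪 → ℝ^k` which is uniformly intrinsically
differentiable at every point of the open set `𝒪` is locally little-1/2-Hölder
continuous with respect to the group quasi-norm. -/
theorem statement2 (m n k : ℕ) (hm : 2 ≤ m) (hn : 1 ≤ n) (hk : 1 ≤ k) (hkm : k < m)
    (b : Fin n → Matrix (Fin m) (Fin m) ℝ)
    (hskew : ∀ s, (b s).transpose = -(b s)) (hind : LinearIndependent ℝ b)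
    (hblock : ∀ s (i j : Fin m), (i : ℕ) < k → (j : ℕ) < k → b s i j = 0)
    (O : Set (W m n k)) (hO : IsOpen O) (φ : W m n k → Fin k → ℝ)
    (huid : ∀ A₀ ∈ O, ∃ M, UID m n k b O φ A₀ M) :
    ∀ K ⊆ O, IsCompact K → ∀ ε > 0, ∃ r > 0, ∀ A ∈ K, ∀ B ∈ K,
      0 < dW m n k b A B → dW m n k b A B < r →
      enorm (fun j => φ B j - φ A j) ≤ ε * Real.sqrt (dW m n k b A B) := by
  intro K hKO hK ε hε
  suffices h : ∃ r > 0, ∀ A ∈ K, A ∈ O → ∀ B ∈ O, 0 < dW m n k b A B → dW m n k b A B < r →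
      enorm (fun j => φ B j - φ A j) ≤ ε * Real.sqrt (dW m n k b A B) by
    obtain ⟨r, hr, hd⟩ := h
    exact ⟨r, hr, fun A hA B hB => hd A hA (hKO hA) B (hKO hB)⟩
  refine hK.induction_on (p := fun s => ∃ r > 0, ∀ A ∈ s, A ∈ O → ∀ B ∈ O,
    0 < dW m n k b A B → dW m n k b A B < r →
      enorm (fun j => φ B j - φ A j) ≤ ε * Real.sqrt (dW m n k b A B)) ?_ ?_ ?_ ?_
  · exact ⟨1, one_pos, by simp⟩
  · rintro s t hst ⟨r, hr, hd⟩
    exact ⟨r, hr, fun A hA => hd A (hst hA)⟩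
  · rintro s t ⟨r, hr, hd⟩ ⟨r', hr', hd'⟩
    refine ⟨min r r', lt_min hr hr', fun A hA hAO B hB hpos hlt => ?_⟩
    rcases hA with hA | hA
    · exact hd A hA hAO B hB hpos (hlt.trans_le (min_le_left _ _))
    · exact hd' A hA hAO B hB hpos (hlt.trans_le (min_le_right _ _))
  · intro A₀ hA₀
    obtain ⟨M, hM⟩ := huid A₀ (hKO hA₀)
    obtain ⟨r, hr, hev⟩ := hM.exists_eventually_enorm_sub_le hskew (hKO hA₀) hε
    exact ⟨_, mem_nhdsWithin_of_mem_nhds hev, r, hr, fun A hA => hA⟩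

end Carnot
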